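/- Let K_{1,4,0}, …, K_{1,4,15} be the 16 sub-control polygons (each a piecewise linear curve on 7 points) produced by 4 iterations of de Casteljau subdivision at parameter 1/2 applied to K_1, indexed cyclically in order. Then for cyclically consecutive indices i and i+1 (mod 16), the convex hulls of the point sets of K_{1,4,i} and K_{1,4,i+1} intersect exactly in the single shared endpoint, and for all other pairs of distinct indices the convex hulls are disjoint. -/

import Mathlib

open Set Real

noncomputable section

/-- Points in ℝ³. -/
abbrev V3 : Type := Fin 3 → ℝ

/-- The point (x, y, z) ∈ ℝ³. -/
def pt (x y z : ℝ) : V3 := ![x, y, z]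

/-- Standard parameterization on `[0,1]` of the piecewise linear curve through
`P 0, P 1, …, P m`, traversing the `m` edges in order at constant speed. -/
def plPath (P : ℕ → V3) (m : ℕ) (t : ℝ) : V3 :=
  let s := t * m
  let i := ⌊s⌋.toNat
  (1 - (s - i)) • P i + (s - i) • P (i + 1)

/-- An ambient isotopy between subsets `X` and `Y` of ℝ³: a continuous map
`H : ℝ³ × [0,1] → ℝ³` with `H(·,0) = id`, each `H(·,t)` a homeomorphism of ℝ³
onto itself, and `H(X × {1}) = Y`. -/
def AmbientIsotopic (X Y : Set V3) : Prop :=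
  ∃ H : V3 → ℝ → V3,
    ContinuousOn (fun p : V3 × ℝ => H p.1 p.2) (univ ×ˢ Icc (0 : ℝ) 1) ∧
    (∀ x, H x 0 = x) ∧
    (∀ t ∈ Icc (0 : ℝ) 1, ∃ h : V3 ≃ₜ V3, ∀ x, H x t = h x) ∧
    (fun x => H x 1) '' X = Y

/-- The round circle {(x, y, 0) : x² + y² = 1}. -/
def unitCircle : Set V3 := {p : V3 | ∃ x y : ℝ, x ^ 2 + y ^ 2 = 1 ∧ p = pt x y 0}

/-- The standard trefoil, the image of
`t ↦ ((2 + cos 3t) cos 2t, (2 + cos 3t) sin 2t, sin 3t)` for `t ∈ [0, 2π]`. -/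
def trefoil : Set V3 :=
  {p : V3 | ∃ t ∈ Icc (0 : ℝ) (2 * π),
    p = pt ((2 + cos (3 * t)) * cos (2 * t)) ((2 + cos (3 * t)) * sin (2 * t)) (sin (3 * t))}

/-- Cyclic vertex function determined by a list of points. -/
def vertsOf (L : List V3) : ℕ → V3 := fun m => L.getD (m % L.length) 0

/-- The vertices of the closed PL curve K₀. -/
def K0verts : List V3 :=
  [pt 0 9 20, pt (-15) (-95) (-50), pt 40 80 (-20), pt (-10) (-60) 58,
   pt (-60) 30 20, pt 40 (-60) (-60)]

/-- The vertices of the closed PL curve K₁ (the vertex (−10,−60,58) of K₀ is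
replaced by (10,−60,58)). -/
def K1verts : List V3 :=
  [pt 0 9 20, pt (-15) (-95) (-50), pt 40 80 (-20), pt 10 (-60) 58,
   pt (-60) 30 20, pt 40 (-60) (-60)]

/-- The standard loop parameterization of K₀. -/
def K0loop : ℝ → V3 := plPath (vertsOf K0verts) 6

/-- The standard loop parameterization of K₁. -/
def K1loop : ℝ → V3 := plPath (vertsOf K1verts) 6

/-- The closed PL curve K₀ as a subset of ℝ³. -/
def K0 : Set V3 := K0loop '' Icc 0 1

/-- The closed PL curve K₁ as a subset of ℝ³. -/
def K1 : Set V3 := K1loop '' Icc 0 1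

/-- The de Casteljau points `P_i^{(k)}` at parameter 1/2:
`P_i^{(0)} = P_i` and `P_i^{(k)} = (P_i^{(k-1)} + P_{i+1}^{(k-1)})/2`. -/
def dcQ (P : ℕ → V3) : ℕ → ℕ → V3
  | 0, i => P i
  | k + 1, i => (1 / 2 : ℝ) • (dcQ P k i + dcQ P k (i + 1))

/-- Left half of one de Casteljau subdivision step at parameter 1/2:
`(P_0^{(0)}, P_0^{(1)}, …, P_0^{(n)})`. -/
def dcLeft (P : ℕ → V3) : ℕ → V3 := fun i => dcQ P i 0

/-- Right half of one de Casteljau subdivision step at parameter 1/2 on a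
degree-`n` control polygon: `(P_0^{(n)}, P_1^{(n-1)}, …, P_n^{(0)})`. -/
def dcRight (n : ℕ) (P : ℕ → V3) : ℕ → V3 := fun i => dcQ P (n - i) i

/-- The list of `2^k` sub-control polygons, in order, produced by `k` iterations
of de Casteljau subdivision at parameter 1/2 on a degree-`n` control polygon. -/
def subPolys (n : ℕ) : ℕ → (ℕ → V3) → List (ℕ → V3)
  | 0, P => [P]
  | k + 1, P => subPolys n k (dcLeft P) ++ subPolys n k (dcRight n P)

/-- Vertex function (cyclic) of the concatenation, in order, of a list of
degree-`n` control polygons whose consecutive endpoints agree. -/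
def concatVerts (n : ℕ) (L : List (ℕ → V3)) : ℕ → V3 :=
  fun m =>
    let m' := m % (n * L.length)
    (L.getD (m' / n) fun _ => 0) (m' % n)

/-- The standard loop parameterization of the closed PL curve obtained from the
degree-6 control polygon `Q` by `k` iterations of de Casteljau subdivision at
parameter 1/2 (concatenating the `2^k` sub-control polygons in order). -/
def Ksub (k : ℕ) (Q : ℕ → V3) : ℝ → V3 :=
  plPath (concatVerts 6 (subPolys 6 k Q)) (6 * 2 ^ k)

/-- The Bézier curve of degree `n` with control points `P 0, …, P n`. -/
def bezier (n : ℕ) (P : ℕ → V3) (t : ℝ) : V3 :=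
  ∑ i ∈ Finset.range (n + 1), ((n.choose i : ℝ) * t ^ i * (1 - t) ^ (n - i)) • P i

/-- The `i`-th of the 16 sub-control polygons produced by 4 iterations of
de Casteljau subdivision at parameter 1/2 applied to K₁. -/
def polyK14 (i : ℕ) : ℕ → V3 := (subPolys 6 4 (vertsOf K1verts)).getD i fun _ => 0

/-- The convex hull of the point set of a degree-6 control polygon. -/
def chull6 (Q : ℕ → V3) : Set V3 := convexHull ℝ (Q '' {i : ℕ | i ≤ 6})

/-- The linear form on ℝ³ with integer coefficients `d`. -/
def intForm (d : ℤ × ℤ × ℤ) : V3 →ₗ[ℝ] ℝ :=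
  (d.1 : ℝ) • LinearMap.proj 0 + (d.2.1 : ℝ) • LinearMap.proj 1 + (d.2.2 : ℝ) • LinearMap.proj 2

/-- The integer list `L` holds the values of `c • f` at the points `Q 0, …, Q n`. -/
def Represents (n : ℕ) (c : ℝ) (f : V3 →ₗ[ℝ] ℝ) (Q : ℕ → V3) (L : List ℤ) : Prop :=
  ∀ i ≤ n, c * f (Q i) = L.getD i 0

/-- The `k`-fold iterated sums of adjacent entries: the de Casteljau points scaled by `2 ^ k`. -/
def adjSum (L : List ℤ) : ℕ → ℕ → ℤ
  | 0, i => L.getD i 0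
  | k + 1, i => adjSum L k i + adjSum L k (i + 1)

/-- Scalar version of `dcLeft`, scaled by `2 ^ n`. -/
def intLeft (n : ℕ) (L : List ℤ) : List ℤ :=
  (List.range (n + 1)).map fun i => 2 ^ (n - i) * adjSum L i 0

/-- Scalar version of `dcRight`, scaled by `2 ^ n`. -/
def intRight (n : ℕ) (L : List ℤ) : List ℤ :=
  (List.range (n + 1)).map fun i => 2 ^ i * adjSum L (n - i) i

/-- Scalar version of `subPolys`, scaled by `2 ^ (n * k)`. -/
def intSubPolys (n : ℕ) : ℕ → List ℤ → List (List ℤ)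
  | 0, L => [L]
  | k + 1, L => intSubPolys n k (intLeft n L) ++ intSubPolys n k (intRight n L)

theorem Represents.adjSum {n : ℕ} {c : ℝ} {f : V3 →ₗ[ℝ] ℝ} {Q : ℕ → V3} {L : List ℤ}
    (h : Represents n c f Q L) (k i : ℕ) (hi : k + i ≤ n) :
    2 ^ k * (c * f (dcQ Q k i)) = adjSum L k i := by
  induction k generalizing i with
  | zero => simpa [dcQ, _root_.adjSum] using h i (by omega)
  | succ k ih =>
    have h₁ := ih i (by omega)
    have h₂ := ih (i + 1) (by omega)
    simp only [dcQ, _root_.adjSum, map_smul, map_add, smul_eq_mul, Int.cast_add, ← h₁, ← h₂]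
    ring

theorem Represents.left {n : ℕ} {c : ℝ} {f : V3 →ₗ[ℝ] ℝ} {Q : ℕ → V3} {L : List ℤ}
    (h : Represents n c f Q L) : Represents n (2 ^ n * c) f (dcLeft Q) (intLeft n L) := by
  intro i hi
  have h₁ := h.adjSum i 0 (by omega)
  obtain ⟨j, rfl⟩ := Nat.exists_eq_add_of_le hi
  simp [intLeft, dcLeft, ← h₁, List.getD_eq_getElem?_getD, pow_add]
  ring

theorem Represents.right {n : ℕ} {c : ℝ} {f : V3 →ₗ[ℝ] ℝ} {Q : ℕ → V3} {L : List ℤ}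
    (h : Represents n c f Q L) : Represents n (2 ^ n * c) f (dcRight n Q) (intRight n L) := by
  intro i hi
  have h₁ := h.adjSum (n - i) i (by omega)
  obtain ⟨j, rfl⟩ := Nat.exists_eq_add_of_le hi
  simp only [Nat.add_sub_cancel_left] at h₁
  simp [intRight, dcRight, ← h₁, List.getD_eq_getElem?_getD, pow_add]
  ring

theorem Represents.subPolys {n : ℕ} {c : ℝ} {f : V3 →ₗ[ℝ] ℝ} {Q : ℕ → V3} {L : List ℤ}
    (h : Represents n c f Q L) (k : ℕ) :
    List.Forall₂ (Represents n ((2 ^ n) ^ k * c) f) (subPolys n k Q) (intSubPolys n k L) := by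
  induction k generalizing c Q L with
  | zero => simpa [_root_.subPolys, intSubPolys] using h
  | succ k ih =>
    rw [pow_succ, mul_assoc]
    exact List.rel_append (ih h.left) (ih h.right)

theorem List.Forall₂.getD {α β : Type*} {R : α → β → Prop} {l : List α} {m : List β}
    (h : List.Forall₂ R l m) {a : α} {b : β} (hab : R a b) (i : ℕ) :
    R (l.getD i a) (m.getD i b) := by
  induction h generalizing i with
  | nil => simpa using hab
  | cons h _ ih => cases i <;> simp_all

/-- The values of the form with coefficients `d` at the vertices of `K₁`. -/
def formK1 (d : ℤ × ℤ × ℤ) : List ℤ :=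
  [(0, 9, 20), (-15, -95, -50), (40, 80, -20), (10, -60, 58), (-60, 30, 20), (40, -60, -60),
    (0, 9, 20)].map fun p : ℤ × ℤ × ℤ => d.1 * p.1 + d.2.1 * p.2.1 + d.2.2 * p.2.2

theorem represents_formK1 (d : ℤ × ℤ × ℤ) :
    Represents 6 1 (intForm d) (vertsOf K1verts) (formK1 d) := by
  intro i hi
  interval_cases i <;> simp [intForm, vertsOf, K1verts, formK1, pt]

/-- The values of the form with coefficients `d` on the `i`-th control polygon, scaled by
`2 ^ 24`. -/
def formK14 (d : ℤ × ℤ × ℤ) (i : ℕ) : List ℤ := (intSubPolys 6 4 (formK1 d)).getD i []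

theorem represents_formK14 (d : ℤ × ℤ × ℤ) (i : ℕ) :
    Represents 6 (2 ^ 24) (intForm d) (polyK14 i) (formK14 d i) := by
  have h := ((represents_formK1 d).subPolys 4).getD (a := fun _ => 0) (b := [])
    (fun i _ => by simp) i
  norm_num at h ⊢
  exact h

theorem intForm_lt_iff (d : ℤ × ℤ × ℤ) {i j a b : ℕ} (ha : a ≤ 6) (hb : b ≤ 6) :
    intForm d (polyK14 i a) < intForm d (polyK14 j b) ↔
      (formK14 d i).getD a 0 < (formK14 d j).getD b 0 := by
  rw [← Int.cast_lt (R := ℝ), ← represents_formK14 d i a ha, ← represents_formK14 d j b hb,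
    mul_lt_mul_iff_right₀ (by positivity)]

theorem intForm_eq_iff (d : ℤ × ℤ × ℤ) {i j a b : ℕ} (ha : a ≤ 6) (hb : b ≤ 6) :
    intForm d (polyK14 i a) = intForm d (polyK14 j b) ↔
      (formK14 d i).getD a 0 = (formK14 d j).getD b 0 := by
  rw [← Int.cast_inj (α := ℝ), ← represents_formK14 d i a ha, ← represents_formK14 d j b hb,
    mul_right_inj' (by positivity)]

/-- Coefficients of linear forms that separate the control polygons of `K₁,₄`. -/
def separators : List (ℤ × ℤ × ℤ) :=
  [(1, 0, 0), (0, 1, 0), (0, 0, 1), (0, 1, -1), (1, 1, 0), (2, -1, 1)]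

theorem shared_endpoint_values : ∀ i : Fin 16, ∀ d ∈ separators.take 3,
    (formK14 d i).getD 6 0 = (formK14 d (i + 1 : Fin 16)).getD 0 0 := by
  decide +kernel

theorem exists_separator : ∀ i j : Fin 16, i ≠ j → i + 1 ≠ j → j + 1 ≠ i →
    ∃ d ∈ separators, (∀ a < 7, ∀ b < 7, (formK14 d i).getD a 0 < (formK14 d j).getD b 0) ∨
      ∀ a < 7, ∀ b < 7, (formK14 d j).getD a 0 < (formK14 d i).getD b 0 := by
  decide +kernel

theorem exists_adjacent_separator : ∀ i : Fin 16, ∃ d ∈ separators,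
    (∀ a < 6, (formK14 d i).getD a 0 < (formK14 d i).getD 6 0 ∧
      (formK14 d i).getD 6 0 < (formK14 d (i + 1 : Fin 16)).getD (a + 1) 0) ∨
    ∀ a < 6, (formK14 d i).getD 6 0 < (formK14 d i).getD a 0 ∧
      (formK14 d (i + 1 : Fin 16)).getD (a + 1) 0 < (formK14 d i).getD 6 0 := by
  decide +kernel

theorem disjoint_chull6_of_lt (f : V3 →ₗ[ℝ] ℝ) {P Q : ℕ → V3}
    (h : ∀ a ≤ 6, ∀ b ≤ 6, f (P a) < f (Q b)) : Disjoint (chull6 P) (chull6 Q) := by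
  have hP : ∀ b ≤ 6, chull6 P ⊆ {x | f x < f (Q b)} := fun b hb =>
    convexHull_min (image_subset_iff.2 fun a ha => h a ha b hb)
      (convex_halfSpace_lt f.isLinear _)
  rw [Set.disjoint_left]
  intro x hx hx'
  have hQ : chull6 Q ⊆ {y | f x < f y} :=
    convexHull_min (image_subset_iff.2 fun b hb => hP b hb hx)
      (convex_halfSpace_gt f.isLinear _)
  exact lt_irrefl (f x) (hQ hx')

theorem convex_insert_halfSpace_lt {E : Type*} [AddCommGroup E] [Module ℝ E] (f : E →ₗ[ℝ] ℝ)
    (v : E) : Convex ℝ {x | x = v ∨ f x < f v} := by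
  rw [convex_iff_forall_pos]
  intro x hx y hy a b ha hb hab
  have key : a * f v + b * f v = f v := by rw [← add_mul, hab, one_mul]
  simp only [mem_ofPred_eq, map_add, map_smul, smul_eq_mul] at hx hy ⊢
  rcases hx with rfl | hx <;> rcases hy with rfl | hy
  · exact Or.inl (by rw [← add_smul, hab, one_smul])
  all_goals right; nlinarith

theorem chull6_inter_eq_singleton_of_lt (f : V3 →ₗ[ℝ] ℝ) {P Q : ℕ → V3} (h : P 6 = Q 0)
    (hlt : ∀ a < 6, f (P a) < f (P 6) ∧ f (P 6) < f (Q (a + 1))) :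
    chull6 P ∩ chull6 Q = {P 6} := by
  have hP : chull6 P ⊆ {x | x = P 6 ∨ f x < f (P 6)} := by
    refine convexHull_min (image_subset_iff.2 fun a ha => ?_) (convex_insert_halfSpace_lt f _)
    rcases (show a ≤ 6 from ha).eq_or_lt with rfl | ha
    · exact Or.inl rfl
    · exact Or.inr (hlt a ha).1
  have hQ : chull6 Q ⊆ {x | x = P 6 ∨ (-f) x < (-f) (P 6)} := by
    refine convexHull_min (image_subset_iff.2 fun a ha => ?_) (convex_insert_halfSpace_lt (-f) _)
    rcases a with _ | a
    · exact Or.inl h.symm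
    · exact Or.inr (neg_lt_neg (hlt a ha).2)
  refine Subset.antisymm (fun x hx => ?_) (singleton_subset_iff.2 ⟨?_, ?_⟩)
  · rcases hP hx.1 with hx₁ | hx₁
    · exact hx₁
    · rcases hQ hx.2 with hx₂ | hx₂
      · exact hx₂
      · exact absurd hx₁ (neg_lt_neg_iff.1 hx₂).not_gt
  · exact subset_convexHull ℝ _ (mem_image_of_mem P (show 6 ≤ 6 from le_rfl))
  · rw [h]
    exact subset_convexHull ℝ _ (mem_image_of_mem Q (Nat.zero_le 6))

theorem polyK14_six_eq_next_zero (i : Fin 16) : polyK14 i 6 = polyK14 (i + 1 : Fin 16) 0 := by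
  have h := fun d hd => (intForm_eq_iff d le_rfl (Nat.zero_le 6)).2 (shared_endpoint_values i d hd)
  have h₀ := h (1, 0, 0) (by decide)
  have h₁ := h (0, 1, 0) (by decide)
  have h₂ := h (0, 0, 1) (by decide)
  ext k
  fin_cases k
  · simpa [intForm] using h₀
  · simpa [intForm] using h₁
  · simpa [intForm] using h₂

/-- cyclically consecutive sub-control polygons of K₁,₄ have
convex hulls meeting exactly in the shared endpoint, and all other pairs of
convex hulls are disjoint. -/
theorem K14_hulls_pairwise_disjoint :
    (∀ i : Fin 16,
      chull6 (polyK14 i.val) ∩ chull6 (polyK14 (i + 1).val) = {polyK14 i.val 6}) ∧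
    (∀ i j : Fin 16, i ≠ j → i + 1 ≠ j → j + 1 ≠ i →
      Disjoint (chull6 (polyK14 i.val)) (chull6 (polyK14 j.val))) := by
  refine ⟨fun i => ?_, fun i j hij hi hj => ?_⟩
  · obtain ⟨d, -, h | h⟩ := exists_adjacent_separator i
    · exact chull6_inter_eq_singleton_of_lt (intForm d) (polyK14_six_eq_next_zero i) fun a ha =>
        ⟨(intForm_lt_iff d ha.le le_rfl).2 (h a ha).1, (intForm_lt_iff d le_rfl ha).2 (h a ha).2⟩
    · exact chull6_inter_eq_singleton_of_lt (-intForm d) (polyK14_six_eq_next_zero i) fun a ha =>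
        ⟨neg_lt_neg ((intForm_lt_iff d le_rfl ha.le).2 (h a ha).1),
          neg_lt_neg ((intForm_lt_iff d ha le_rfl).2 (h a ha).2)⟩
  · obtain ⟨d, -, h | h⟩ := exists_separator i j hij hi hj
    · exact disjoint_chull6_of_lt (intForm d) fun a ha b hb =>
        (intForm_lt_iff d ha hb).2 (h a (by omega) b (by omega))
    · exact (disjoint_chull6_of_lt (intForm d) fun a ha b hb =>
        (intForm_lt_iff d ha hb).2 (h a (by omega) b (by omega))).symm
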